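/- Let α, β be nonzero real numbers with α ≠ β, and suppose at least one of α, β is rational. Let f : ℝ → ℂ be measurable, with d₁,d₂,d₃,d₄ ∈ ℂ not all zero satisfying d₁f(x) + d₂f(x+1) + d₃f(x+1)e^{2πiαx} + d₄f(x+1)e^{2πiβx} = 0 for almost every x ∈ ℝ, and suppose f has minimal decay: for almost every x ∈ ℝ, f(x+n) → 0 as n → +∞ and as n → −∞ along the integers. Then f = 0 almost everywhere. -/

import Mathlib

open MeasureTheory Filter

/-- `e x = e^{2πix}`. -/
noncomputable def e (x : ℝ) : ℂ := Complex.exp (2 * Real.pi * Complex.I * x)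

section Phases

theorem norm_e (x : ℝ) : ‖e x‖ = 1 := by
  have h : e x = Complex.exp (((2 * Real.pi * x : ℝ) : ℂ) * Complex.I) := by
    unfold e; congr 1; push_cast; ring
  rw [h, Complex.norm_exp_ofReal_mul_I]

theorem e_add (x y : ℝ) : e (x + y) = e x * e y := by
  unfold e; rw [← Complex.exp_add]; congr 1; push_cast; ring

theorem e_intCast (n : ℤ) : e n = 1 := by
  unfold e
  rw [Complex.exp_eq_one_iff]
  exact ⟨n, by push_cast; ring⟩

theorem e_neg (x : ℝ) : e (-x) = starRingEnd ℂ (e x) := by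
  unfold e
  rw [← Complex.exp_conj]
  congr 1
  simp [map_ofNat]

theorem norm_e_sub_e_le (x y : ℝ) (m : ℤ) : ‖e x - e y‖ ≤ 2 * Real.pi * |x - y - m| := by
  have h : e x - e y = e y * (Complex.exp (Complex.I * (2 * Real.pi * (x - y - m) : ℝ)) - 1) := by
    have hx : e x = e (y + (x - y - m) + m) := by congr 1; ring
    have he : e (x - y - m) = Complex.exp (Complex.I * (2 * Real.pi * (x - y - m) : ℝ)) := by
      unfold e; congr 1; push_cast; ring
    rw [hx, e_add, e_intCast, e_add, he]; ring
  rw [h, norm_mul, norm_e, one_mul]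
  refine Real.norm_exp_I_mul_ofReal_sub_one_le.trans ?_
  rw [Real.norm_eq_abs, abs_mul, abs_of_pos Real.two_pi_pos]

theorem hasDerivAt_e_mul (a x : ℝ) :
    HasDerivAt (fun t : ℝ => e (a * t)) (2 * Real.pi * Complex.I * a * e (a * x)) x := by
  have h : HasDerivAt (fun t : ℝ => 2 * Real.pi * Complex.I * ((a * t : ℝ) : ℂ))
      (2 * Real.pi * Complex.I * a) x := by
    have := (((hasDerivAt_id x).const_mul a).ofReal_comp).const_mul (2 * Real.pi * Complex.I)
    simpa using this
  unfold e
  rw [mul_comm (2 * Real.pi * Complex.I * (a : ℂ))]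
  exact h.cexp

theorem analyticAt_e_mul (a x : ℝ) : AnalyticAt ℝ (fun t : ℝ => e (a * t)) x := by
  unfold e
  have h1 : AnalyticAt ℝ (fun t : ℝ => ((a * t : ℝ) : ℂ)) x :=
    (Complex.ofRealCLM.analyticAt _).comp (analyticAt_const.mul analyticAt_id)
  have h2 : AnalyticAt ℝ (fun t : ℝ => 2 * Real.pi * Complex.I * ((a * t : ℝ) : ℂ)) x :=
    analyticAt_const.mul h1
  exact (analyticAt_cexp.restrictScalars (𝕜 := ℝ)).comp h2

/-- A trigonometric polynomial with distinct frequencies `0, s, t` vanishes only on a null set. -/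
theorem ae_add_mul_e_add_mul_e_ne_zero {s t : ℝ} (hs : s ≠ 0) (ht : t ≠ 0) (hst : s ≠ t)
    {a b c : ℂ} (habc : a ≠ 0 ∨ b ≠ 0 ∨ c ≠ 0) :
    ∀ᵐ x : ℝ, a + b * e (s * x) + c * e (t * x) ≠ 0 := by
  have han : AnalyticOnNhd ℝ (fun x : ℝ => a + b * e (s * x) + c * e (t * x)) Set.univ :=
    fun x _ => (analyticAt_const.add (analyticAt_const.mul (analyticAt_e_mul s x))).add
      (analyticAt_const.mul (analyticAt_e_mul t x))
  rcases han.eqOn_zero_or_eventually_ne_zero_of_preconnected isPreconnected_univ with h0 | h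
  · exfalso
    have hpi : (2 * Real.pi * Complex.I : ℂ) ≠ 0 := Complex.two_pi_I_ne_zero
    have hs' : (s : ℂ) ≠ 0 := by exact_mod_cast hs
    have ht' : (t : ℂ) ≠ 0 := by exact_mod_cast ht
    have hst' : (s : ℂ) - t ≠ 0 := sub_ne_zero.2 (by exact_mod_cast hst)
    have z0 : ∀ x : ℝ, a + b * e (s * x) + c * e (t * x) = 0 := fun x => h0 (Set.mem_univ x)
    have z1 : ∀ x : ℝ, b * s * e (s * x) + c * t * e (t * x) = 0 := by
      intro x
      have hd := (((hasDerivAt_e_mul s x).const_mul b).const_add a).add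
        ((hasDerivAt_e_mul t x).const_mul c)
      have hz : HasDerivAt (fun _ : ℝ => (0 : ℂ)) 0 x := hasDerivAt_const x 0
      have := hd.unique (hz.congr_of_eventuallyEq (Eventually.of_forall z0))
      refine (mul_eq_zero.1 (?_ : 2 * Real.pi * Complex.I *
        (b * s * e (s * x) + c * t * e (t * x)) = 0)).resolve_left hpi
      rw [← this]; ring
    have z2 : b * s * s * e (s * 0) + c * t * t * e (t * 0) = 0 := by
      have hd := ((hasDerivAt_e_mul s 0).const_mul (b * s)).add
        ((hasDerivAt_e_mul t 0).const_mul (c * t))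
      have hz : HasDerivAt (fun _ : ℝ => (0 : ℂ)) 0 (0 : ℝ) := hasDerivAt_const 0 0
      have := hd.unique (hz.congr_of_eventuallyEq (Eventually.of_forall z1))
      refine (mul_eq_zero.1 (?_ : 2 * Real.pi * Complex.I *
        (b * s * s * e (s * 0) + c * t * t * e (t * 0)) = 0)).resolve_left hpi
      rw [← this]; ring
    have he : e 0 = 1 := by simp [e]
    have w0 := z0 0
    have w1 := z1 0
    simp only [mul_zero, he, mul_one] at w0 w1 z2
    have hb : b = 0 := by
      have : b * (s * (s - t)) = 0 := by linear_combination z2 - t * w1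
      exact (mul_eq_zero.1 this).resolve_right (mul_ne_zero hs' hst')
    have hc : c = 0 := by
      have : c * t = 0 := by simpa [hb] using w1
      exact (mul_eq_zero.1 this).resolve_right ht'
    have ha : a = 0 := by simpa [hb, hc] using w0
    simp [ha, hb, hc] at habc
  · have := ae_restrict_le_codiscreteWithin (μ := volume) MeasurableSet.univ h
    rw [Measure.restrict_univ] at this
    exact this

theorem ae_norm_add_mul_e_ne {s : ℝ} (hs : s ≠ 0) {a b : ℂ} (ha : a ≠ 0) (hb : b ≠ 0) (r : ℝ) :
    ∀ᵐ x : ℝ, ‖a + b * e (s * x)‖ ≠ r := by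
  have hne : s ≠ -s := fun h => hs (by linarith)
  have hab : starRingEnd ℂ a * b ≠ 0 := mul_ne_zero (by simpa using ha) hb
  filter_upwards [ae_add_mul_e_add_mul_e_ne_zero hs (neg_ne_zero.2 hs) hne
    (a := a * starRingEnd ℂ a + b * starRingEnd ℂ b - r ^ 2) (b := starRingEnd ℂ a * b)
    (c := a * starRingEnd ℂ b) (Or.inr (Or.inl hab))] with x hx hr
  apply hx
  have h1 : (a + b * e (s * x)) * starRingEnd ℂ (a + b * e (s * x)) = (r : ℂ) ^ 2 := by
    rw [Complex.mul_conj, Complex.normSq_eq_norm_sq, hr]; push_cast; rfl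
  have h2 : e (s * x) * starRingEnd ℂ (e (s * x)) = 1 := by
    rw [Complex.mul_conj, Complex.normSq_eq_norm_sq, norm_e]; simp
  rw [neg_mul, e_neg]
  simp only [map_add, map_mul] at h1
  linear_combination h1 - b * starRingEnd ℂ b * h2

end Phases

section Recurrence

/-- Infinitely many `k` with `k * ξ` within `1 / k` of an integer, for every real `ξ`. -/
theorem exists_large_nat_abs_mul_sub_le (ξ : ℝ) (K : ℕ) :
    ∃ k : ℕ, K ≤ k ∧ 0 < k ∧ ∃ m : ℤ, |k * ξ - m| ≤ 1 / k := by
  by_cases hint : ∃ k : ℕ, 0 < k ∧ ∃ m : ℤ, k * ξ = m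
  · obtain ⟨k, hk, m, hm⟩ := hint
    refine ⟨(K + 1) * k, ?_, by positivity, (K + 1) * m, ?_⟩
    · nlinarith
    · have : (((K + 1) * k : ℕ) : ℝ) * ξ - (((K + 1) * m : ℤ) : ℝ) = 0 := by
        push_cast; linear_combination ((K : ℝ) + 1) * hm
      rw [this, abs_zero]; positivity
  · push Not at hint
    obtain ⟨n, hn⟩ : ∃ n : ℕ, ∀ k ∈ Finset.Icc 1 K, 1 / ((n : ℝ) + 1) < |k * ξ - round (k * ξ)| := by
      have : ∀ᶠ n : ℕ in atTop, ∀ k ∈ Finset.Icc 1 K,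
          1 / ((n : ℝ) + 1) < |k * ξ - round (k * ξ)| := by
        rw [eventually_all_finset]
        intro k hk
        refine tendsto_one_div_add_atTop_nhds_zero_nat.eventually_lt_const ?_
        exact abs_pos.2 (sub_ne_zero.2 (hint k (Finset.mem_Icc.1 hk).1 _))
      exact this.exists
    obtain ⟨k, hk0, hkn, hk⟩ := Real.exists_nat_abs_mul_sub_round_le ξ (Nat.succ_pos n)
    have hkR : (0 : ℝ) < k := by exact_mod_cast hk0
    refine ⟨k, ?_, hk0, round (k * ξ), hk.trans ?_⟩
    · by_contra hlt
      have := hn k (Finset.mem_Icc.2 ⟨hk0, by omega⟩)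
      have h2 : 1 / (((n.succ : ℕ) : ℝ) + 1) ≤ 1 / ((n : ℝ) + 1) := by
        apply one_div_le_one_div_of_le (by positivity); push_cast; linarith
      linarith
    · apply one_div_le_one_div_of_le hkR
      have : (k : ℝ) ≤ n.succ := by exact_mod_cast hkn
      linarith

theorem eq_mul_prod_of_eq_mul {u v : ℤ → ℝ} (huv : ∀ n, u n = u (n + 1) * v n) (n : ℤ) (N : ℕ) :
    u n = u (n + N) * ∏ k ∈ Finset.range N, v (n + k) := by
  induction N with
  | zero => simp
  | succ N ih =>
    rw [Finset.prod_range_succ, ih, huv (n + N)]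
    push_cast
    rw [← add_assoc]; ring

theorem eq_zero_of_tendsto_of_almost_period {u v : ℤ → ℝ} (hu : ∀ n, 0 ≤ u n)
    (huv : ∀ n, u n = u (n + 1) * v n) (htop : Tendsto u atTop (nhds 0))
    (hbot : Tendsto u atBot (nhds 0)) {δ C : ℝ} (hδ : 0 < δ) (hC : 0 ≤ C) (hv : ∀ n, δ ≤ v n)
    (hper : ∀ K : ℕ, ∃ N : ℕ, K ≤ N ∧ 0 < N ∧ ∀ n : ℤ, v n ≤ v (n - N) + C / N) : u 0 = 0 := by
  by_contra hne
  have hpos : 0 < u 0 := lt_of_le_of_ne (hu 0) (Ne.symm hne)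
  have hlim : Tendsto (fun N : ℕ => u N * u (-N)) atTop (nhds 0) := by
    have h1 : Tendsto (fun N : ℕ => u N) atTop (nhds 0) := htop.comp tendsto_natCast_atTop_atTop
    have h2 : Tendsto (fun N : ℕ => u (-N)) atTop (nhds 0) :=
      hbot.comp (tendsto_neg_atTop_atBot.comp tendsto_natCast_atTop_atTop)
    simpa using h1.mul h2
  set D := C / δ with hD
  have hD0 : 0 ≤ D := by positivity
  obtain ⟨K, hK⟩ := eventually_atTop.1
    (hlim.eventually_lt_const (show 0 < u 0 ^ 2 / Real.exp D by positivity))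
  obtain ⟨N, hKN, hN, hvN⟩ := hper K
  have hNR : (0 : ℝ) < N := by exact_mod_cast hN
  have hprod : ∏ k ∈ Finset.range N, v ((0 : ℤ) + k)
      ≤ Real.exp D * ∏ k ∈ Finset.range N, v (-(N : ℤ) + k) := by
    have hexp : Real.exp D = ∏ _k ∈ Finset.range N, Real.exp (D / N) := by
      rw [Finset.prod_const, Finset.card_range, ← Real.exp_nat_mul]
      congr 1; field_simp
    rw [hexp, ← Finset.prod_mul_distrib]
    refine Finset.prod_le_prod (fun k _ => hδ.le.trans (hv _)) fun k _ => ?_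
    have h1 := hvN (0 + k)
    have h2 : (0 + (k : ℤ) - N) = -N + k := by ring
    rw [h2] at h1
    have h3 := hv (-N + k)
    have h4 : C / N ≤ D / N * v (-N + k) := by
      have : C / N = D / N * δ := by rw [hD]; field_simp
      rw [this]; gcongr
    have h5 := Real.add_one_le_exp (D / N)
    nlinarith
  have e1 := eq_mul_prod_of_eq_mul huv 0 N
  have e2 := eq_mul_prod_of_eq_mul huv (-N) N
  rw [neg_add_cancel] at e2
  rw [zero_add] at e1
  have hlt := hK N hKN
  rw [lt_div_iff₀ (Real.exp_pos D)] at hlt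
  have : u 0 ^ 2 ≤ u N * u (-N) * Real.exp D := by
    calc u 0 ^ 2 = u 0 * (u N * ∏ k ∈ Finset.range N, v ((0 : ℤ) + k)) := by rw [← e1]; ring
      _ ≤ u 0 * (u N * (Real.exp D * ∏ k ∈ Finset.range N, v (-(N : ℤ) + k))) := by
        gcongr
        exact hu _
      _ = u N * u (-N) * Real.exp D := by rw [e2]; ring
  linarith

/-- A nonnegative sequence tending to zero in both directions attains its maximum for the
first time somewhere. -/
theorem exists_first_max {u : ℤ → ℝ} (hpos : 0 < u 0) (htop : Tendsto u atTop (nhds 0))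
    (hbot : Tendsto u atBot (nhds 0)) : ∃ m, u 0 ≤ u m ∧ (∀ n, u n ≤ u m) ∧ ∀ n < m, u n < u m := by
  have hfin : {n | u 0 ≤ u n}.Finite := by
    have h1 := htop.eventually_lt_const hpos
    have h2 := hbot.eventually_lt_const hpos
    obtain ⟨a, ha⟩ := eventually_atTop.1 h1
    obtain ⟨b, hb⟩ := eventually_atBot.1 h2
    refine (Set.finite_Icc b a).subset fun n hn => ⟨?_, ?_⟩
    · by_contra h
      exact absurd (hb n (by omega)) (not_lt.2 hn)
    · by_contra h
      exact absurd (ha n (by omega)) (not_lt.2 hn)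
  obtain ⟨m, hm, hmax⟩ := Set.exists_max_image _ u hfin ⟨0, le_refl (u 0)⟩
  have hmax' : ∀ n, u n ≤ u m := fun n => by
    by_cases h : u 0 ≤ u n
    · exact hmax n h
    · exact (not_le.1 h).le.trans hm
  obtain ⟨l, hl, hmin⟩ := Set.exists_min_image {n | u m ≤ u n} id
    (hfin.subset fun n (hn : u m ≤ u n) => (le_trans hm hn : u 0 ≤ u n)) ⟨m, le_refl (u m)⟩
  refine ⟨l, le_trans hm hl, fun n => (hmax' n).trans hl, fun n hn => ?_⟩
  by_contra h
  exact absurd (hmin n (le_trans hl (not_lt.1 h))) (not_le.2 hn)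

theorem exists_prod_bounds_of_tendsto {u v : ℤ → ℝ} (hv : ∀ n, 0 ≤ v n)
    (huv : ∀ n, u n = u (n + 1) * v n) (htop : Tendsto u atTop (nhds 0))
    (hbot : Tendsto u atBot (nhds 0)) (hpos : 0 < u 0) :
    ∃ m : ℤ, (∀ N : ℕ, 1 ≤ ∏ k ∈ Finset.range N, v (m + k)) ∧
      ∀ N : ℕ, 0 < N → ∏ k ∈ Finset.range N, v (m - N + k) < 1 := by
  obtain ⟨m, h0, hmax, hfirst⟩ := exists_first_max hpos htop hbot
  have hm : 0 < u m := hpos.trans_le h0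
  refine ⟨m, fun N => ?_, fun N hN => ?_⟩
  · have h1 := eq_mul_prod_of_eq_mul huv m N
    have h2 : 0 ≤ ∏ k ∈ Finset.range N, v (m + k) := Finset.prod_nonneg fun _ _ => hv _
    have h3 := mul_le_mul_of_nonneg_right (hmax (m + N)) h2
    rw [← h1] at h3
    exact (le_mul_iff_one_le_right hm).1 h3
  · have h1 := eq_mul_prod_of_eq_mul huv (m - N) N
    rw [sub_add_cancel] at h1
    have h2 := hfirst (m - N) (by omega)
    rw [h1] at h2
    exact (mul_lt_iff_lt_one_right hm).1 h2

end Recurrence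

section Circle

theorem ae_coe_mul_notMem_of_null {M : Set UnitAddCircle} (hM : MeasurableSet M)
    (h0 : volume M = 0) {c : ℝ} (hc : c ≠ 0) : ∀ᵐ x : ℝ, ((c * x : ℝ) : UnitAddCircle) ∉ M := by
  have hpre : volume ((fun x : ℝ => (x : UnitAddCircle)) ⁻¹' M) = 0 := by
    have hloc : ∀ n : ℤ, volume.restrict (Set.Ioc (n : ℝ) (n + 1))
        ((fun x : ℝ => (x : UnitAddCircle)) ⁻¹' M) = 0 := fun n => by
      rw [(AddCircle.measurePreserving_mk 1 (n : ℝ)).measure_preimage hM.nullMeasurableSet]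
      exact h0
    have hcov : (⋃ n : ℤ, Set.Ioc (n : ℝ) (n + 1)) = Set.univ := iUnion_Ioc_intCast ℝ
    rw [← Measure.restrict_univ (μ := (volume : Measure ℝ)), ← hcov]
    exact le_antisymm ((Measure.restrict_iUnion_le _).trans (by simp [Measure.sum_apply_of_countable, hloc])) zero_le
  have := Real.volume_preimage_mul_left hc ((fun x : ℝ => (x : UnitAddCircle)) ⁻¹' M)
  rw [hpre, mul_zero] at this
  exact measure_eq_zero_iff_ae_notMem.1 this

/-- Points of the circle whose rotation orbit carries a multiplicative cocycle with a first
maximum at time zero form a wandering set. -/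
theorem volume_first_max_eq_zero {h : UnitAddCircle → ℝ} (hh : Measurable h) (c : UnitAddCircle) :
    MeasurableSet {y | (∀ N : ℕ, 1 ≤ ∏ k ∈ Finset.range N, h (y + k • c)) ∧
      ∀ N : ℕ, 0 < N → ∏ k ∈ Finset.range N, h (y - N • c + k • c) < 1} ∧
    volume {y | (∀ N : ℕ, 1 ≤ ∏ k ∈ Finset.range N, h (y + k • c)) ∧
      ∀ N : ℕ, 0 < N → ∏ k ∈ Finset.range N, h (y - N • c + k • c) < 1} = 0 := by
  set M := {y | (∀ N : ℕ, 1 ≤ ∏ k ∈ Finset.range N, h (y + k • c)) ∧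
      ∀ N : ℕ, 0 < N → ∏ k ∈ Finset.range N, h (y - N • c + k • c) < 1} with hMdef
  have hM : MeasurableSet M := by
    refine MeasurableSet.inter (s₁ := {y | ∀ N : ℕ, 1 ≤ ∏ k ∈ Finset.range N, h (y + k • c)}) ?_
      (s₂ := {y | ∀ N : ℕ, 0 < N → ∏ k ∈ Finset.range N, h (y - N • c + k • c) < 1}) ?_
    · rw [Set.ofPred_forall]
      refine MeasurableSet.iInter fun N => measurableSet_le measurable_const ?_
      exact Finset.measurable_fun_prod _ fun k _ => hh.comp (measurable_id.add_const _)
    · simp only [Set.ofPred_forall]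
      refine MeasurableSet.iInter fun N => MeasurableSet.iInter fun _ =>
        measurableSet_lt ?_ measurable_const
      exact Finset.measurable_fun_prod _ fun k _ =>
        hh.comp ((measurable_id.sub_const _).add_const _)
  refine ⟨hM, ?_⟩
  by_contra hne
  obtain ⟨y, hy, m, hm, hy'⟩ := (measurePreserving_add_right (volume : Measure UnitAddCircle)
    c).exists_mem_iterate_mem hM.nullMeasurableSet hne
  rw [add_right_iterate] at hy'
  have h1 := hy.1 m
  have h2 := hy'.2 m (Nat.pos_of_ne_zero hm)
  rw [add_sub_cancel_right] at h2
  linarith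

theorem ae_int_translates {P : ℝ → Prop} (h : ∀ᵐ x : ℝ, P x) : ∀ᵐ x : ℝ, ∀ n : ℤ, P (x + n) :=
  ae_all_iff.2 fun n =>
    (measurePreserving_add_right volume (n : ℝ)).quasiMeasurePreserving.ae h

theorem ae_eq_zero_of_single_phase {f p : ℝ → ℂ} {h : UnitAddCircle → ℝ} (hh : Measurable h)
    {c : ℝ} (hc : c ≠ 0) (hp : ∀ x, ‖p x‖ = h ((c * x : ℝ) : UnitAddCircle))
    (hfp : ∀ᵐ x : ℝ, f x = f (x + 1) * p x)
    (hdecay : ∀ᵐ x : ℝ, Tendsto (fun n : ℤ => f (x + n)) atTop (nhds 0) ∧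
      Tendsto (fun n : ℤ => f (x + n)) atBot (nhds 0)) :
    ∀ᵐ x : ℝ, f x = 0 := by
  obtain ⟨hM, hM0⟩ := volume_first_max_eq_zero hh (c : UnitAddCircle)
  filter_upwards [ae_int_translates hfp, hdecay,
    ae_int_translates (ae_coe_mul_notMem_of_null hM hM0 hc)] with x hx hd hnot
  by_contra hne
  obtain ⟨m, hm1, hm2⟩ := exists_prod_bounds_of_tendsto (u := fun n : ℤ => ‖f (x + n)‖)
    (v := fun n : ℤ => ‖p (x + n)‖) (fun _ => norm_nonneg _)
    (fun n => by rw [hx n, norm_mul]; push_cast; rw [add_assoc])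
    (by simpa using hd.1.norm) (by simpa using hd.2.norm) (by simpa using hne)
  refine hnot m ⟨fun N => (hm1 N).trans_eq ?_, fun N hN => (hm2 N hN).trans_eq' ?_⟩
  · refine Finset.prod_congr rfl fun k _ => ?_
    rw [hp]
    congr 1
    rw [← AddCircle.coe_nsmul, ← AddCircle.coe_add]
    congr 1; push_cast; simp only [nsmul_eq_mul]; ring
  · refine Finset.prod_congr rfl fun k _ => ?_
    rw [hp]
    congr 1
    rw [← AddCircle.coe_nsmul, ← AddCircle.coe_nsmul, ← AddCircle.coe_sub, ← AddCircle.coe_add]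
    congr 1; push_cast; simp only [nsmul_eq_mul]; ring

theorem ae_eq_zero_of_norm_eq_single_phase {f p : ℝ → ℂ} (a b : ℂ) {c : ℝ} (hc : c ≠ 0)
    (hp : ∀ x, ‖p x‖ = ‖a + b * e (c * x)‖) (hfp : ∀ᵐ x : ℝ, f x = f (x + 1) * p x)
    (hdecay : ∀ᵐ x : ℝ, Tendsto (fun n : ℤ => f (x + n)) atTop (nhds 0) ∧
      Tendsto (fun n : ℤ => f (x + n)) atBot (nhds 0)) :
    ∀ᵐ x : ℝ, f x = 0 := by
  refine ae_eq_zero_of_single_phase (h := fun y => ‖a + b * (AddCircle.toCircle y : ℂ)‖)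
    (Continuous.measurable ?_) hc (fun x => ?_) hfp hdecay
  · exact (continuous_const.add (continuous_const.mul
      (continuous_subtype_val.comp AddCircle.continuous_toCircle))).norm
  · rw [hp, AddCircle.toCircle_apply_mk, Circle.coe_exp, e]
    congr 4
    push_cast; ring

end Circle

section ThreeTerms

theorem exists_pos_le_of_periodic {g : ℤ → ℝ} (hg : ∀ n, 0 < g n) {L : ℕ} (hL : 0 < L)
    (hper : ∀ n k : ℤ, g (n + k * L) = g n) : ∃ δ, 0 < δ ∧ ∀ n, δ ≤ g n := by
  obtain ⟨m, -, hm⟩ := (Finset.Ico (0 : ℤ) L).exists_min_image g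
    ⟨0, Finset.mem_Ico.2 ⟨le_rfl, by exact_mod_cast hL⟩⟩
  refine ⟨g m, hg m, fun n => ?_⟩
  have hL' : (0 : ℤ) < L := by exact_mod_cast hL
  have h := hm (n % L) (Finset.mem_Ico.2 ⟨Int.emod_nonneg _ hL'.ne', Int.emod_lt_of_pos _ hL'⟩)
  have h2 := hper (n % L) (n / L)
  rw [Int.emod_add_ediv_mul] at h2
  exact h.trans_eq h2.symm

theorem ae_eq_zero_of_eq_mul_three_terms {α β : ℝ} (hα : α ≠ 0) (hβ : β ≠ 0) (hαβ : α ≠ β)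
    (hrat : ∃ q : ℚ, (q : ℝ) = α) {f : ℝ → ℂ} (a b c : ℂ)
    (hfp : ∀ᵐ x : ℝ, f x = f (x + 1) * (a + b * e (α * x) + c * e (β * x)))
    (hdecay : ∀ᵐ x : ℝ, Tendsto (fun n : ℤ => f (x + n)) atTop (nhds 0) ∧
      Tendsto (fun n : ℤ => f (x + n)) atBot (nhds 0)) :
    ∀ᵐ x : ℝ, f x = 0 := by
  rcases eq_or_ne b 0 with rfl | hb
  · exact ae_eq_zero_of_norm_eq_single_phase a c hβ (fun x => by simp) hfp hdecay
  rcases eq_or_ne a 0 with rfl | ha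
  · refine ae_eq_zero_of_norm_eq_single_phase b c (sub_ne_zero.2 hαβ.symm) (fun x => ?_) hfp hdecay
    have h : 0 + b * e (α * x) + c * e (β * x) = e (α * x) * (b + c * e ((β - α) * x)) := by
      have : e (β * x) = e (α * x) * e ((β - α) * x) := by rw [← e_add]; congr 1; ring
      rw [this]; ring
    rw [h, norm_mul, norm_e, one_mul]
  obtain ⟨q, hq⟩ := hrat
  set L := q.den with hLdef
  have hL : 0 < L := q.den_pos
  have hLR : (0 : ℝ) < L := by exact_mod_cast hL
  have hαL : α * L = q.num := by
    rw [← hq]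
    exact_mod_cast q.mul_den_eq_num
  have hαper : ∀ (x : ℝ) (k : ℤ), e (α * (x + k * L)) = e (α * x) := fun x k => by
    have : α * (x + k * L) = α * x + ((k * q.num : ℤ) : ℝ) := by
      push_cast; linear_combination (k : ℝ) * hαL
    rw [this, e_add, e_intCast, mul_one]
  filter_upwards [ae_int_translates hfp, hdecay,
    ae_int_translates (ae_norm_add_mul_e_ne hα ha hb ‖c‖)] with x hx hd hne
  obtain ⟨δ, hδ, hgap⟩ := exists_pos_le_of_periodic
    (g := fun n : ℤ => |‖a + b * e (α * (x + n))‖ - ‖c‖|)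
    (fun n => abs_pos.2 (sub_ne_zero.2 (hne n))) hL fun n k => by
      have : x + ((n + k * (L : ℤ) : ℤ) : ℝ) = x + n + k * L := by push_cast; ring
      simp only [this, hαper]
  have key := eq_zero_of_tendsto_of_almost_period (u := fun n : ℤ => ‖f (x + n)‖)
    (v := fun n : ℤ => ‖a + b * e (α * (x + n)) + c * e (β * (x + n))‖)
    (C := ‖c‖ * (2 * Real.pi) * L) (fun _ => norm_nonneg _)
    (fun n => by rw [hx n, norm_mul]; push_cast; rw [add_assoc])
    (by simpa using hd.1.norm) (by simpa using hd.2.norm) hδ (by positivity) (fun n => ?_)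
    (fun K => ?_)
  · simpa using key
  · have h := abs_norm_sub_norm_le (a + b * e (α * (x + n))) (-(c * e (β * (x + n))))
    rw [sub_neg_eq_add, norm_neg, norm_mul c, norm_e, mul_one] at h
    exact (hgap n).trans h
  · obtain ⟨k, hKk, hk, m, hm⟩ := exists_large_nat_abs_mul_sub_le (β * L) K
    have hkR : (0 : ℝ) < k := by exact_mod_cast hk
    refine ⟨k * L, hKk.trans (Nat.le_mul_of_pos_right k hL), by positivity, fun n => ?_⟩
    have hshift : x + ((n - ((k * L : ℕ) : ℤ) : ℤ) : ℝ) = x + n + ((-k : ℤ) : ℝ) * L := by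
      push_cast; ring
    rw [hshift, hαper]
    have h1 := norm_e_sub_e_le (β * (x + n)) (β * (x + n + ((-k : ℤ) : ℝ) * L)) m
    have h2 : β * (x + n) - β * (x + n + ((-k : ℤ) : ℝ) * L) - m = k * (β * L) - m := by
      push_cast; ring
    rw [h2] at h1
    have h3 := norm_le_norm_add_norm_sub' (a + b * e (α * (x + n)) + c * e (β * (x + n)))
      (a + b * e (α * (x + n)) + c * e (β * (x + n + ((-k : ℤ) : ℝ) * L)))
    refine h3.trans (add_le_add le_rfl ?_)
    rw [add_sub_add_left_eq_sub, ← mul_sub, norm_mul]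
    calc ‖c‖ * ‖e (β * (x + n)) - e (β * (x + n + ((-k : ℤ) : ℝ) * L))‖
        ≤ ‖c‖ * (2 * Real.pi * (1 / k)) := by
          gcongr
          exact h1.trans (by gcongr)
      _ = ‖c‖ * (2 * Real.pi) * L / ((k * L : ℕ) : ℝ) := by push_cast; field_simp

end ThreeTerms

/-- For the special (1,3) configuration `(0,0),(1,0),(1,α),(1,β)` with at least one of
`α, β` rational, no nontrivial measurable solution with minimal decay along integer
translates exists. -/
theorem hrt_minimal_decay_special_one_three_rational
    (α β : ℝ) (hα : α ≠ 0) (hβ : β ≠ 0) (hαβ : α ≠ β)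
    (hrat : (∃ q : ℚ, (q : ℝ) = α) ∨ (∃ q : ℚ, (q : ℝ) = β))
    (f : ℝ → ℂ) (hf : Measurable f)
    (d : Fin 4 → ℂ) (hd : ∃ i, d i ≠ 0)
    (heq : ∀ᵐ x : ℝ, d 0 * f x + d 1 * f (x + 1) + d 2 * f (x + 1) * e (α * x)
      + d 3 * f (x + 1) * e (β * x) = 0)
    (hdecay : ∀ᵐ x : ℝ, Tendsto (fun n : ℤ => f (x + n)) atTop (nhds 0) ∧
      Tendsto (fun n : ℤ => f (x + n)) atBot (nhds 0)) :
    ∀ᵐ x : ℝ, f x = 0 := by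
  by_cases h0 : d 0 = 0
  · have hne : d 1 ≠ 0 ∨ d 2 ≠ 0 ∨ d 3 ≠ 0 := by
      obtain ⟨i, hi⟩ := hd
      fin_cases i
      · exact absurd h0 hi
      · exact Or.inl hi
      · exact Or.inr (Or.inl hi)
      · exact Or.inr (Or.inr hi)
    have h : ∀ᵐ x : ℝ, f (x + 1) = 0 := by
      filter_upwards [heq, ae_add_mul_e_add_mul_e_ne_zero hα hβ hαβ hne] with x hx hp
      refine (mul_eq_zero.1 (?_ : f (x + 1) * (d 1 + d 2 * e (α * x) + d 3 * e (β * x)) = 0))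
        |>.resolve_right hp
      rw [h0] at hx
      linear_combination hx
    filter_upwards [ae_int_translates h] with x hx
    simpa using hx (-1)
  · rcases hrat with hrat | hrat
    · refine ae_eq_zero_of_eq_mul_three_terms hα hβ hαβ hrat (-d 1 / d 0) (-d 2 / d 0) (-d 3 / d 0)
        ?_ hdecay
      filter_upwards [heq] with x hx
      generalize e (α * x) = z at hx ⊢
      generalize e (β * x) = w at hx ⊢
      field_simp
      linear_combination hx
    · refine ae_eq_zero_of_eq_mul_three_terms hβ hα hαβ.symm hrat (-d 1 / d 0) (-d 3 / d 0)
        (-d 2 / d 0) ?_ hdecay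
      filter_upwards [heq] with x hx
      generalize e (α * x) = z at hx ⊢
      generalize e (β * x) = w at hx ⊢
      field_simp
      linear_combination hx
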